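/- arXiv:2509.15798 — 2 statements merged into one kernel-verified Lean document; each statement's English description precedes it below -/
import Mathlib

section
/- The following are equivalent: (i) for every w = (μ, ν) ∈ ℝ^q × ℝ^p one has E[(Y − m)·exp(i⟨μ, 𝒀⟩ + i⟨ν, 𝑿⟩)] = 0; (ii) for every (μ, ν) ∈ ℝ^q × ℝ^p one has E[(Y − m)·exp(i⟨μ, 𝒀⟩)·(exp(i⟨ν, 𝑿⟩) − φ(ν))] = 0. (Equivalence of the unconditional moment formulation and the doubly robust formulation of the null hypothesis of no Granger causality in mean.) -/
open MeasureTheory Complex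

/-- The residual `Y - E[Y | m]` is orthogonal to bounded `m`-measurable complex functions. -/
theorem residual_orthogonal {Ω : Type*} {m m0 : MeasurableSpace Ω} (hm : m ≤ m0)
    (P : Measure Ω) [IsProbabilityMeasure P] (Y : Ω → ℝ) (hY : Integrable Y P)
    (g : Ω → ℂ) (hg : StronglyMeasurable[m] g) (c : ℝ) (hc : ∀ᵐ ω ∂P, ‖g ω‖ ≤ c) :
    ∫ ω, ((Y ω - (P[Y | m]) ω : ℝ) : ℂ) * g ω ∂P = 0 := by
  have hg0 : AEStronglyMeasurable g P := (hg.mono hm).aestronglyMeasurable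
  have h1 : Integrable (Y • g) P := hY.smul_bdd c hg0 hc
  have h2 : Integrable ((P[Y | m]) • g) P := integrable_condExp.smul_bdd c hg0 hc
  have h3 := condExp_smul_of_aestronglyMeasurable_right (m := m) hY h1 hg.aestronglyMeasurable
  have h4 : ∫ ω, ((P[Y | m]) • g) ω ∂P = ∫ ω, (Y • g) ω ∂P := by
    rw [← integral_condExp hm (f := Y • g)]
    exact integral_congr_ae h3.symm
  have h5 : (fun ω => ((Y ω - (P[Y | m]) ω : ℝ) : ℂ) * g ω)
      = fun ω => (Y • g) ω - ((P[Y | m]) • g) ω := by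
    funext ω
    simp only [Pi.smul_apply', Complex.real_smul, Complex.ofReal_sub]
    ring
  rw [h5, integral_sub h1 h2, h4, sub_self]

/-- Equivalence of the unconditional moment formulation and the doubly robust
formulation of the null hypothesis of no Granger causality in mean. -/
theorem doubly_robust_hypothesis_equivalence
    {Ω : Type*} [m0 : MeasurableSpace Ω] (P : Measure Ω) [IsProbabilityMeasure P]
    {q p : ℕ} (Yv : Ω → (Fin q → ℝ)) (Xv : Ω → (Fin p → ℝ)) (Y : Ω → ℝ)
    (hYv : Measurable Yv) (hXv : Measurable Xv) (hY : Integrable Y P) :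
    (∀ (μ : Fin q → ℝ) (ν : Fin p → ℝ),
        ∫ ω, ((Y ω - (P[Y | MeasurableSpace.comap Yv inferInstance]) ω : ℝ) : ℂ) *
          Complex.exp (Complex.I *
            (((∑ i, μ i * Yv ω i : ℝ) : ℂ) + ((∑ j, ν j * Xv ω j : ℝ) : ℂ))) ∂P = 0)
    ↔
    (∀ (μ : Fin q → ℝ) (ν : Fin p → ℝ),
        ∫ ω, ((Y ω - (P[Y | MeasurableSpace.comap Yv inferInstance]) ω : ℝ) : ℂ) *
          Complex.exp (Complex.I * ((∑ i, μ i * Yv ω i : ℝ) : ℂ)) *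
          (Complex.exp (Complex.I * ((∑ j, ν j * Xv ω j : ℝ) : ℂ)) -
            (P[(fun ω => Complex.exp (Complex.I * ((∑ j, ν j * Xv ω j : ℝ) : ℂ))) |
                MeasurableSpace.comap Yv inferInstance]) ω) ∂P = 0) := by
  have hm : MeasurableSpace.comap Yv inferInstance ≤ m0 := hYv.comap_le
  refine forall_congr' fun μ => forall_congr' fun ν => ?_
  set m : MeasurableSpace Ω := MeasurableSpace.comap Yv inferInstance with hmdef
  set e : Ω → ℂ := fun ω => Complex.exp (Complex.I * ((∑ i, μ i * Yv ω i : ℝ) : ℂ)) with he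
  set f : Ω → ℂ := fun ω => Complex.exp (Complex.I * ((∑ j, ν j * Xv ω j : ℝ) : ℂ)) with hf
  have hYm : Measurable[m] Yv := comap_measurable Yv
  have hem : Measurable[m] e := by
    have hφ : Measurable (fun y : Fin q → ℝ =>
        Complex.exp (Complex.I * ((∑ i, μ i * y i : ℝ) : ℂ))) := by fun_prop
    exact hφ.comp hYm
  have hfm : Measurable[m0] f := by
    have hφ : Measurable (fun y : Fin p → ℝ =>
        Complex.exp (Complex.I * ((∑ i, ν i * y i : ℝ) : ℂ))) := by fun_prop
    exact hφ.comp hXv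
  have he1 : ∀ ω, ‖e ω‖ = 1 := fun ω => by
    simp only [he]; exact Complex.norm_exp_I_mul_ofReal _
  have hf1 : ∀ ω, ‖f ω‖ = 1 := fun ω => by
    simp only [hf]; exact Complex.norm_exp_I_mul_ofReal _
  have hφ1 : ∀ᵐ ω ∂P, ‖(P[f | m]) ω‖ ≤ 1 :=
    ae_bdd_norm_condExp_of_ae_bdd_norm (Filter.Eventually.of_forall fun ω => (hf1 ω).le)
  have hgm : StronglyMeasurable[m] (fun ω => e ω * (P[f | m]) ω) :=
    hem.stronglyMeasurable.mul stronglyMeasurable_condExp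
  have hgb : ∀ᵐ ω ∂P, ‖e ω * (P[f | m]) ω‖ ≤ 1 := by
    filter_upwards [hφ1] with ω hω
    rw [norm_mul, he1, one_mul]; exact hω
  have hR : Integrable (fun ω => ((Y ω - (P[Y | m]) ω : ℝ) : ℂ)) P :=
    (hY.sub integrable_condExp).ofReal
  have key := residual_orthogonal hm P Y hY _ hgm 1 hgb
  have i2 : Integrable (fun ω => ((Y ω - (P[Y | m]) ω : ℝ) : ℂ) * (e ω * (P[f | m]) ω)) P :=
    hR.mul_bdd (c := 1) (hgm.mono hm).aestronglyMeasurable hgb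
  have i1 : Integrable (fun ω => ((Y ω - (P[Y | m]) ω : ℝ) : ℂ) * (e ω * f ω)) P :=
    hR.mul_bdd (c := 1) ((hem.mono hm le_rfl).mul hfm).aestronglyMeasurable
      (Filter.Eventually.of_forall fun ω => by rw [norm_mul, he1, hf1, one_mul])
  have hA : (fun ω => ((Y ω - (P[Y | m]) ω : ℝ) : ℂ) *
      Complex.exp (Complex.I *
        (((∑ i, μ i * Yv ω i : ℝ) : ℂ) + ((∑ j, ν j * Xv ω j : ℝ) : ℂ))))
      = fun ω => ((Y ω - (P[Y | m]) ω : ℝ) : ℂ) * (e ω * f ω) := by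
    funext ω
    rw [mul_add, Complex.exp_add]
  have hB : (fun ω => ((Y ω - (P[Y | m]) ω : ℝ) : ℂ) * e ω * (f ω - (P[f | m]) ω))
      = fun ω => ((Y ω - (P[Y | m]) ω : ℝ) : ℂ) * (e ω * f ω)
        - ((Y ω - (P[Y | m]) ω : ℝ) : ℂ) * (e ω * (P[f | m]) ω) := by
    funext ω
    ring
  have hI : ∫ ω, ((Y ω - (P[Y | m]) ω : ℝ) : ℂ) * e ω * (f ω - (P[f | m]) ω) ∂P
      = ∫ ω, ((Y ω - (P[Y | m]) ω : ℝ) : ℂ) * (e ω * f ω) ∂P := by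
    rw [hB, integral_sub i1 i2, key, sub_zero]
  rw [hA]
  exact ⟨fun h => hI.trans h, fun h => hI.symm.trans h⟩
end

section
/- E[Z | σ(W)] = 0 P-almost surely if and only if E[Z·exp(i⟨w, W⟩)] = 0 for every w ∈ ℝ^d. (The complex exponential is a generically comprehensively revealing family: the conditional moment restriction E[Z | W] = 0 a.s. is equivalent to the continuum of unconditional moment restrictions indexed by w.) -/
open MeasureTheory Complex

lemma key_integral
    {Ω : Type*} [m0 : MeasurableSpace Ω] (P : Measure Ω) [IsProbabilityMeasure P]
    {d : ℕ} (Z : Ω → ℝ) (W : Ω → (Fin d → ℝ))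
    (hZ : Integrable Z P) (hW : Measurable W) (g : (Fin d → ℝ) → ℂ) (hg : Measurable g)
    (hb : ∀ x, ‖g x‖ ≤ 1) :
    ∫ ω, (Z ω : ℂ) * g (W ω) ∂P =
      ∫ x, g x ∂((P.withDensity (fun ω => ENNReal.ofReal (Z ω))).map W) -
      ∫ x, g x ∂((P.withDensity (fun ω => ENNReal.ofReal (-Z ω))).map W) := by
  have h1 : ∀ Y : Ω → ℝ, Integrable Y P →
      ∫ x, g x ∂((P.withDensity (fun ω => ENNReal.ofReal (Y ω))).map W) =
        ∫ ω, ((max (Y ω) 0 : ℝ) : ℂ) * g (W ω) ∂P := by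
    intro Y hY
    rw [integral_map hW.aemeasurable hg.aestronglyMeasurable,
      integral_withDensity_eq_integral_toReal_smul₀ hY.1.aemeasurable.ennreal_ofReal
        (by simp)]
    refine integral_congr_ae (Filter.Eventually.of_forall fun ω => ?_)
    simp [ENNReal.toReal_ofReal']
  have h2 : ∀ Y : Ω → ℝ, Integrable Y P →
      Integrable (fun ω => ((max (Y ω) 0 : ℝ) : ℂ) * g (W ω)) P := by
    intro Y hY
    exact (hY.pos_part.ofReal (𝕜 := ℂ)).mul_bdd
      (hg.comp hW).aestronglyMeasurable (c := 1) (Filter.Eventually.of_forall fun ω => hb _)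
  rw [h1 Z hZ, h1 (fun ω => -Z ω) hZ.neg, ← integral_sub (h2 Z hZ) (h2 (fun ω => -Z ω) hZ.neg)]
  refine integral_congr_ae (Filter.Eventually.of_forall fun ω => ?_)
  simp only
  rw [← sub_mul, ← Complex.ofReal_sub]
  congr 2
  rcases le_total (Z ω) 0 with h | h
  · simp [h]
  · simp [h]

/-- The complex exponential family is generically comprehensively revealing: the
conditional moment restriction `E[Z | W] = 0` a.s. is equivalent to the continuum of
unconditional moment restrictions `E[Z · exp(i⟨w, W⟩)] = 0` for all `w`. -/
theorem condexp_zero_iff_exp_moments_zero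
    {Ω : Type*} [m0 : MeasurableSpace Ω] (P : Measure Ω) [IsProbabilityMeasure P]
    {d : ℕ} (Z : Ω → ℝ) (W : Ω → (Fin d → ℝ))
    (hZ : Integrable Z P) (hW : Measurable W) :
    (P[Z | MeasurableSpace.comap W inferInstance] =ᵐ[P] 0)
    ↔
    (∀ w : Fin d → ℝ,
      ∫ ω, (Z ω : ℂ) * Complex.exp (Complex.I * ((∑ i, w i * W ω i : ℝ) : ℂ)) ∂P = 0) := by
  have hm : MeasurableSpace.comap W inferInstance ≤ m0 := hW.comap_le
  have key := key_integral P Z W hZ hW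
  have hf1 : IsFiniteMeasure (P.withDensity (fun ω => ENNReal.ofReal (Z ω))) :=
    isFiniteMeasure_withDensity_ofReal hZ.2
  have hf2 : IsFiniteMeasure (P.withDensity (fun ω => ENNReal.ofReal (-Z ω))) :=
    isFiniteMeasure_withDensity_ofReal hZ.neg.2
  set μ := (P.withDensity (fun ω => ENNReal.ofReal (Z ω))).map W with hμ
  set ν := (P.withDensity (fun ω => ENNReal.ofReal (-Z ω))).map W with hν
  have hfμ : IsFiniteMeasure μ := by rw [hμ]; infer_instance
  have hfν : IsFiniteMeasure ν := by rw [hν]; infer_instance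
  have hset : ∀ B : Set (Fin d → ℝ), MeasurableSet B →
      ∫ ω in W ⁻¹' B, Z ω ∂P = μ.real B - ν.real B := by
    intro B hB
    have h := key (B.indicator fun _ => (1 : ℂ)) (measurable_const.indicator hB) (by
      intro x
      by_cases hx : x ∈ B <;> simp [hx])
    rw [integral_indicator_const _ hB, integral_indicator_const _ hB] at h
    have h3 : ∫ ω, (Z ω : ℂ) * B.indicator (fun _ => (1 : ℂ)) (W ω) ∂P
        = ((∫ ω in W ⁻¹' B, Z ω ∂P : ℝ) : ℂ) := by
      rw [← integral_indicator (hW hB), ← integral_complex_ofReal]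
      refine integral_congr_ae (Filter.Eventually.of_forall fun ω => ?_)
      by_cases hx : W ω ∈ B <;> simp [hx, Set.indicator]
    rw [h3] at h
    simp only [Complex.real_smul, mul_one] at h
    exact_mod_cast h
  have hA : (P[Z | MeasurableSpace.comap W inferInstance] =ᵐ[P] 0) ↔ μ = ν := by
    constructor
    · intro h
      ext B hB
      have h4 := setIntegral_condExp hm hZ (s := W ⁻¹' B) ⟨B, hB, rfl⟩
      rw [hset B hB, integral_congr_ae (ae_restrict_of_ae h)] at h4
      simp only [Pi.zero_apply, integral_zero] at h4
      have h5 : μ.real B = ν.real B := by linarith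
      exact (measureReal_eq_measureReal_iff).1 h5
    · intro h
      refine (ae_eq_condExp_of_forall_setIntegral_eq hm hZ (g := 0) ?_ ?_ ?_).symm
      · intro s _ _
        exact integrableOn_zero
      · rintro s ⟨B, hB, rfl⟩ _
        rw [hset B hB, h]
        simp
      · exact aestronglyMeasurable_zero
  have hexp : ∀ w : Fin d → ℝ,
      ∫ ω, (Z ω : ℂ) * Complex.exp (Complex.I * ((∑ i, w i * W ω i : ℝ) : ℂ)) ∂P =
      ∫ x, Complex.exp (Complex.I * ((∑ i, w i * x i : ℝ) : ℂ)) ∂μ -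
      ∫ x, Complex.exp (Complex.I * ((∑ i, w i * x i : ℝ) : ℂ)) ∂ν := by
    intro w
    refine key (fun x => Complex.exp (Complex.I * ((∑ i, w i * x i : ℝ) : ℂ))) ?_ ?_
    · fun_prop
    · intro x
      rw [mul_comm, Complex.norm_exp_ofReal_mul_I]
  rw [hA]
  constructor
  · intro h w
    rw [hexp, h, sub_self]
  · intro h
    refine Measure.ext_of_charFunDual (funext fun L => ?_)
    have h6 := h (fun i => L (Pi.single i 1))
    rw [hexp, sub_eq_zero] at h6
    have hL : ∀ x : Fin d → ℝ, ∑ i, L (Pi.single i 1) * x i = L x := by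
      intro x
      conv_rhs => rw [pi_eq_sum_univ' x, map_sum]
      refine Finset.sum_congr rfl fun i _ => ?_
      rw [map_smul, smul_eq_mul, mul_comm]
    simp only [hL] at h6
    simpa only [charFunDual_apply, mul_comm] using h6
end
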